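/- Let σ be the surface measure on 𝕊^{d-1} ⊂ ℝ^d with d ≥ 2, and let ζ ∈ 𝕊^{d-1} be any fixed unit vector. Then ∫∫_{(𝕊^{d-1})²} |(ω₃ + ω₄)·ζ| dσ(ω₃) dσ(ω₄) = (2^{d-1} Γ(d/2)³)/(π Γ(d − 1/2) Γ((d+1)/2)) · σ(𝕊^{d-1})². -/

import Mathlib

open MeasureTheory Metric Real RealInnerProductSpace

theorem integral_mul_norm_eq_integral_toSphere_mul {E : Type*} [NormedAddCommGroup E]
    [NormedSpace ℝ E] [MeasurableSpace E] [BorelSpace E] [FiniteDimensional ℝ E] [Nontrivial E]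
    (μ : Measure E) [μ.IsAddHaarMeasure] (f : E → ℝ) (g : ℝ → ℝ) :
    ∫ x, f (‖x‖⁻¹ • x) * g ‖x‖ ∂μ
      = (∫ ω, f ω ∂μ.toSphere) * ∫ r in Set.Ioi (0 : ℝ), r ^ (Module.finrank ℝ E - 1) * g r := by
  calc
    ∫ x, f (‖x‖⁻¹ • x) * g ‖x‖ ∂μ
      = ∫ x : ({(0)}ᶜ : Set E), f (‖x.1‖⁻¹ • x.1) * g ‖x.1‖ ∂(μ.comap (↑)) := by
      rw [integral_subtype_comap (measurableSet_singleton _).compl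
        fun x ↦ f (‖x‖⁻¹ • x) * g ‖x‖, restrict_compl_singleton]
    _ = ∫ p, f p.1 * g p.2 ∂μ.toSphere.prod (.volumeIoiPow (Module.finrank ℝ E - 1)) := by
      simpa using μ.measurePreserving_homeomorphUnitSphereProd.integral_comp
        (Homeomorph.measurableEmbedding _)
        (fun p : sphere (0 : E) 1 × Set.Ioi (0 : ℝ) ↦ f p.1 * g p.2)
    _ = (∫ ω, f ω ∂μ.toSphere)
        * ∫ r : Set.Ioi (0 : ℝ), g r ∂.volumeIoiPow (Module.finrank ℝ E - 1) :=
      integral_prod_mul (fun ω : sphere (0 : E) 1 ↦ f ω) (fun r : Set.Ioi (0 : ℝ) ↦ g r)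
    _ = _ := by
      simp only [Measure.volumeIoiPow, ENNReal.ofReal]
      rw [integral_withDensity_eq_integral_smul,
        integral_subtype_comap measurableSet_Ioi
          fun a ↦ Real.toNNReal (a ^ (Module.finrank ℝ E - 1)) • g a,
        setIntegral_congr_fun measurableSet_Ioi fun x hx ↦ ?_]
      · rw [NNReal.smul_def, Real.coe_toNNReal _ (pow_nonneg hx.out.le _), smul_eq_mul]
      · exact (measurable_subtype_coe.pow_const _).real_toNNReal

theorem integral_pow_mul_exp_neg_sq (n : ℕ) :
    ∫ r in Set.Ioi (0 : ℝ), r ^ n * exp (-r ^ 2) = Gamma ((n + 1) / 2) / 2 := by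
  have h := integral_rpow_mul_exp_neg_rpow (p := 2) (q := n) two_pos
    (by linarith [Nat.cast_nonneg (α := ℝ) n])
  norm_cast at h
  push_cast at h
  rw [h]
  ring

theorem integral_toSphere_comp_linearIsometryEquiv {E : Type*} [NormedAddCommGroup E]
    [InnerProductSpace ℝ E] [MeasurableSpace E] [BorelSpace E] [FiniteDimensional ℝ E]
    [Nontrivial E] (L : E ≃ₗᵢ[ℝ] E) (f : E → ℝ) :
    ∫ ω, f (L ω) ∂(volume : Measure E).toSphere = ∫ ω, f ω ∂(volume : Measure E).toSphere := by
  have hL : ∫ x, f (L (‖x‖⁻¹ • x)) * exp (-‖x‖ ^ 2) = ∫ x, f (‖x‖⁻¹ • x) * exp (-‖x‖ ^ 2) := by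
    rw [← L.measurePreserving.integral_comp L.toHomeomorph.measurableEmbedding
      fun x ↦ f (‖x‖⁻¹ • x) * exp (-‖x‖ ^ 2)]
    simp
  have h₁ := integral_mul_norm_eq_integral_toSphere_mul (volume : Measure E) (fun x ↦ f (L x))
    fun r ↦ exp (-r ^ 2)
  have h₂ := integral_mul_norm_eq_integral_toSphere_mul (volume : Measure E) f
    fun r ↦ exp (-r ^ 2)
  rw [integral_pow_mul_exp_neg_sq] at h₁ h₂
  rw [h₁, h₂] at hL
  refine mul_right_cancel₀ (ne_of_gt ?_) hL
  exact div_pos (Gamma_pos_of_pos (by positivity)) two_pos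

theorem exists_linearIsometryEquiv_apply_eq {E : Type*} [NormedAddCommGroup E]
    [InnerProductSpace ℝ E] {v w : E} (h : ‖v‖ = ‖w‖) : ∃ L : E ≃ₗᵢ[ℝ] E, L v = w :=
  ⟨_, Submodule.reflection_sub h⟩

theorem integral_toSphere_inner_eq {E : Type*} [NormedAddCommGroup E]
    [InnerProductSpace ℝ E] [MeasurableSpace E] [BorelSpace E] [FiniteDimensional ℝ E]
    [Nontrivial E] (f : ℝ → ℝ) {v w : E} (h : ‖v‖ = ‖w‖) :
    ∫ ω : sphere (0 : E) 1, f ⟪(ω : E), v⟫ ∂(volume : Measure E).toSphere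
      = ∫ ω : sphere (0 : E) 1, f ⟪(ω : E), w⟫ ∂(volume : Measure E).toSphere := by
  obtain ⟨L, rfl⟩ := exists_linearIsometryEquiv_apply_eq h
  rw [← integral_toSphere_comp_linearIsometryEquiv L fun x ↦ f ⟪x, L v⟫]
  simp

theorem integral_euclideanSpace_succ {n : ℕ} (G : ℝ → (Fin n → ℝ) → ℝ) :
    ∫ x : EuclideanSpace ℝ (Fin (n + 1)), G (x 0) (fun i ↦ x i.succ)
      = ∫ p : ℝ × (Fin n → ℝ), G p.1 p.2 := by
  rw [← (PiLp.volume_preserving_toLp (Fin (n + 1))).integral_comp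
    (MeasurableEquiv.toLp 2 _).measurableEmbedding,
    ← (volume_preserving_piFinSuccAbove (fun _ : Fin (n + 1) ↦ ℝ) 0).integral_comp
      (MeasurableEquiv.measurableEmbedding _)]
  rfl

theorem norm_sq_euclideanSpace_succ {n : ℕ} (x : EuclideanSpace ℝ (Fin (n + 1))) :
    ‖x‖ ^ 2 = x 0 ^ 2 + ∑ i : Fin n, x i.succ ^ 2 := by
  rw [EuclideanSpace.real_norm_sq_eq, Fin.sum_univ_succ]

theorem integral_exp_neg_mul_sum_sq (n : ℕ) (b : ℝ) :
    ∫ y : Fin n → ℝ, exp (-b * ∑ i, y i ^ 2) = √(π / b) ^ n := by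
  simp_rw [Finset.mul_sum, exp_sum]
  rw [integral_fintype_prod_volume_eq_pow fun t : ℝ ↦ exp (-b * t ^ 2), integral_gaussian,
    Fintype.card_fin]

theorem integrable_exp_neg_mul_sum_sq (n : ℕ) {b : ℝ} (hb : 0 < b) :
    Integrable fun y : Fin n → ℝ ↦ exp (-b * ∑ i, y i ^ 2) := by
  simp_rw [Finset.mul_sum, exp_sum]
  exact Integrable.fintype_prod fun _ ↦ integrable_exp_neg_mul_sq hb

theorem integral_toSphere_abs_coord (n : ℕ) :
    ∫ ω : sphere (0 : EuclideanSpace ℝ (Fin (n + 1))) 1, |(ω : EuclideanSpace ℝ (Fin (n + 1))) 0|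
        ∂(volume : Measure (EuclideanSpace ℝ (Fin (n + 1)))).toSphere
      = 2 * √π ^ n / Gamma ((n + 2) / 2) := by
  have h := integral_mul_norm_eq_integral_toSphere_mul
    (volume : Measure (EuclideanSpace ℝ (Fin (n + 1)))) (fun x ↦ |x 0|) fun r ↦ r * exp (-r ^ 2)
  have hr : ∫ r in Set.Ioi (0 : ℝ), r ^ n * (r * exp (-r ^ 2)) = Gamma ((n + 2) / 2) / 2 := by
    simp_rw [← mul_assoc, ← pow_succ]
    rw [integral_pow_mul_exp_neg_sq]
    push_cast
    ring_nf
  have hl : ∫ x : EuclideanSpace ℝ (Fin (n + 1)),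
      |(‖x‖⁻¹ • x) 0| * (‖x‖ * exp (-‖x‖ ^ 2)) = √π ^ n := by
    have : ∀ x : EuclideanSpace ℝ (Fin (n + 1)), |(‖x‖⁻¹ • x) 0| * (‖x‖ * exp (-‖x‖ ^ 2))
        = |x 0| * exp (-x 0 ^ 2) * exp (-1 * ∑ i : Fin n, x i.succ ^ 2) := by
      intro x
      rcases eq_or_ne x 0 with rfl | hx
      · simp
      · have := norm_pos_iff.2 hx
        rw [mul_assoc, ← exp_add, PiLp.smul_apply, smul_eq_mul, abs_mul, abs_inv, abs_norm,
          norm_sq_euclideanSpace_succ]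
        field_simp
        ring_nf
    simp_rw [this]
    rw [integral_euclideanSpace_succ fun t y ↦ |t| * exp (-t ^ 2) * exp (-1 * ∑ i, y i ^ 2),
      Measure.volume_eq_prod, integral_prod_mul (fun t : ℝ ↦ |t| * exp (-t ^ 2))
      (fun y : Fin n → ℝ ↦ exp (-1 * ∑ i, y i ^ 2)), integral_exp_neg_mul_sum_sq]
    have h1 : ∫ t : ℝ, |t| * exp (-t ^ 2) = 1 := by
      have := integral_comp_abs (f := fun t : ℝ ↦ t * exp (-t ^ 2))
      simp only [sq_abs] at this
      rw [this]
      have := integral_pow_mul_exp_neg_sq 1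
      norm_num at this
      rw [this]; norm_num
    rw [h1, div_one, one_mul]
  rw [finrank_euclideanSpace_fin, Nat.add_sub_cancel, hr, hl] at h
  have := Gamma_pos_of_pos (s := ((n : ℝ) + 2) / 2) (by positivity)
  rw [h]
  field_simp

theorem lintegral_parabolic_substitution {q : ℝ} (hq : 0 < q) :
    ∫⁻ t : ℝ, ENNReal.ofReal (√(√(t ^ 2 + q) + t) * exp (-√(t ^ 2 + q)) / √(t ^ 2 + q))
      = ∫⁻ u in Set.Ioi (0 : ℝ),
        ENNReal.ofReal ((√u)⁻¹ * exp (-(u / 2)) * exp (-(2 * u)⁻¹ * q)) := by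
  set φ : ℝ → ℝ := fun u ↦ (u - q / u) / 2 with hφ
  have hsq : ∀ u, 0 < u → √(φ u ^ 2 + q) = (u + q / u) / 2 := by
    intro u hu
    rw [sqrt_eq_iff_mul_self_eq (by positivity) (by positivity)]
    simp only [hφ]
    field_simp
    ring
  have hinj : Set.InjOn φ (Set.Ioi 0) := by
    intro u hu v hv huv
    have hu' := hsq u hu
    have hv' := hsq v hv
    rw [huv, hv'] at hu'
    simp only [hφ] at huv
    linarith
  have himg : φ '' Set.Ioi 0 = Set.univ := by
    refine Set.eq_univ_of_forall fun t ↦ ?_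
    have h : |t| < √(t ^ 2 + q) := by
      rw [← sqrt_sq_eq_abs]
      exact sqrt_lt_sqrt (sq_nonneg t) (by linarith)
    have hpos : 0 < t + √(t ^ 2 + q) := by linarith [neg_abs_le t]
    refine ⟨t + √(t ^ 2 + q), hpos, ?_⟩
    have hs := sq_sqrt (show 0 ≤ t ^ 2 + q by positivity)
    simp only [hφ]
    field_simp
    linear_combination hs
  have hderiv : ∀ u ∈ Set.Ioi (0 : ℝ),
      HasDerivWithinAt φ ((1 + q / u ^ 2) / 2) (Set.Ioi 0) u := by
    intro u hu
    have hu : 0 < u := hu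
    have := (((hasDerivAt_id u).sub ((hasDerivAt_inv hu.ne').const_mul q)).div_const 2)
    refine (this.congr_deriv ?_).hasDerivWithinAt
    field_simp
    ring
  rw [← setLIntegral_univ, ← himg,
    lintegral_image_eq_lintegral_abs_deriv_mul measurableSet_Ioi hderiv hinj]
  refine setLIntegral_congr_fun measurableSet_Ioi fun u hu ↦ ?_
  have hu : 0 < u := hu
  rw [← ENNReal.ofReal_mul (abs_nonneg _), abs_of_pos (by positivity), hsq u hu, mul_assoc,
    ← exp_add]
  have h1 : (u + q / u) / 2 + φ u = u := by simp only [hφ]; ring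
  have h2 : -(u / 2) + -(2 * u)⁻¹ * q = -((u + q / u) / 2) := by field_simp; ring
  rw [h1, h2]
  have h3 : √u * √u = u := mul_self_sqrt hu.le
  congr 1
  have : 0 < √u := sqrt_pos.2 hu
  field_simp
  linear_combination h3

theorem lintegral_parabolic_coordinates {n : ℕ} (hn : n ≠ 0) :
    ∫⁻ p : ℝ × (Fin n → ℝ), ENNReal.ofReal (√(√(p.1 ^ 2 + ∑ i, p.2 i ^ 2) + p.1)
        * exp (-√(p.1 ^ 2 + ∑ i, p.2 i ^ 2)) / √(p.1 ^ 2 + ∑ i, p.2 i ^ 2))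
      = ENNReal.ofReal (√(2 * π) ^ n * (√2 ^ (n + 1) * Gamma ((n + 1) / 2))) := by
  have : Nonempty (Fin n) := Fin.pos_iff_nonempty.1 (Nat.pos_of_ne_zero hn)
  rw [Measure.volume_eq_prod, lintegral_prod_symm _ (by fun_prop)]
  have hsub : ∀ᵐ y : Fin n → ℝ, ∫⁻ t : ℝ, ENNReal.ofReal (√(√(t ^ 2 + ∑ i, y i ^ 2) + t)
        * exp (-√(t ^ 2 + ∑ i, y i ^ 2)) / √(t ^ 2 + ∑ i, y i ^ 2))
      = ∫⁻ u in Set.Ioi (0 : ℝ),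
        ENNReal.ofReal ((√u)⁻¹ * exp (-(u / 2)) * exp (-(2 * u)⁻¹ * ∑ i, y i ^ 2)) := by
    filter_upwards [Measure.ae_ne volume (0 : Fin n → ℝ)] with y hy
    refine lintegral_parabolic_substitution ?_
    obtain ⟨i, hi⟩ := Function.ne_iff.1 hy
    exact Finset.sum_pos' (fun j _ ↦ sq_nonneg _) ⟨i, Finset.mem_univ i, sq_pos_of_ne_zero hi⟩
  rw [lintegral_congr_ae hsub, lintegral_lintegral_swap (by fun_prop)]
  have hgauss : ∀ u ∈ Set.Ioi (0 : ℝ), ∫⁻ y : Fin n → ℝ,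
      ENNReal.ofReal ((√u)⁻¹ * exp (-(u / 2)) * exp (-(2 * u)⁻¹ * ∑ i, y i ^ 2))
      = ENNReal.ofReal (√(2 * π) ^ n
        * (u ^ (((n : ℝ) + 1) / 2 - 1) * exp (-(1 / 2 * u)))) := by
    intro u hu
    have hu : 0 < u := hu
    rw [← ofReal_integral_eq_lintegral_ofReal
      ((integrable_exp_neg_mul_sum_sq n (by positivity)).const_mul _)
      (ae_of_all _ fun _ ↦ by positivity), integral_const_mul, integral_exp_neg_mul_sum_sq]
    congr 1
    have h1 : u ^ (((n : ℝ) + 1) / 2 - 1) = (√u)⁻¹ * √u ^ n := by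
      rw [sqrt_eq_rpow, ← rpow_neg hu.le, ← rpow_natCast, ← rpow_mul hu.le, ← rpow_add hu]
      ring_nf
    have h2 : π / (2 * u)⁻¹ = 2 * π * u := by field_simp
    rw [h1, h2, sqrt_mul (by positivity), mul_pow]
    ring_nf
  have hgamma := integral_rpow_mul_exp_neg_mul_Ioi (a := ((n : ℝ) + 1) / 2) (r := 1 / 2)
    (by positivity) (by norm_num)
  have hpos := Gamma_pos_of_pos (s := ((n : ℝ) + 1) / 2) (by positivity)
  have hint : IntegrableOn
      (fun u : ℝ ↦ u ^ (((n : ℝ) + 1) / 2 - 1) * exp (-(1 / 2 * u))) (Set.Ioi 0) := by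
    refine not_imp_comm.1 integral_undef ?_
    rw [hgamma]
    positivity
  rw [setLIntegral_congr_fun measurableSet_Ioi hgauss, ← ofReal_integral_eq_lintegral_ofReal
    (hint.const_mul _), integral_const_mul, hgamma]
  · congr 3
    rw [one_div_one_div, sqrt_eq_rpow, ← rpow_natCast, ← rpow_mul two_pos.le]
    push_cast
    ring_nf
  · filter_upwards [ae_restrict_mem measurableSet_Ioi] with u hu
    have hu : 0 < u := hu
    positivity

theorem integral_toSphere_sqrt_one_add_coord {n : ℕ} (hn : n ≠ 0) :
    ∫ ω : sphere (0 : EuclideanSpace ℝ (Fin (n + 1))) 1,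
        √(1 + (ω : EuclideanSpace ℝ (Fin (n + 1))) 0)
        ∂(volume : Measure (EuclideanSpace ℝ (Fin (n + 1)))).toSphere
      = √(2 * π) ^ n * (√2 ^ (n + 1) * Gamma ((n + 1) / 2)) / Gamma (n + 1 / 2) := by
  have h := integral_mul_norm_eq_integral_toSphere_mul
    (volume : Measure (EuclideanSpace ℝ (Fin (n + 1)))) (fun x ↦ √(1 + x 0))
    fun r ↦ √r * exp (-r) / r
  have hr : ∫ r in Set.Ioi (0 : ℝ), r ^ n * (√r * exp (-r) / r) = Gamma (n + 1 / 2) := by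
    rw [Gamma_eq_integral (by positivity)]
    refine setIntegral_congr_fun measurableSet_Ioi fun r hr ↦ ?_
    have hr : 0 < r := hr
    have : r ^ ((n : ℝ) + 1 / 2 - 1) = r ^ n * √r / r := by
      rw [rpow_sub_one hr.ne', rpow_add hr, rpow_natCast, sqrt_eq_rpow]
    simp only [this]
    ring
  have hl : ∫ x : EuclideanSpace ℝ (Fin (n + 1)),
      √(1 + (‖x‖⁻¹ • x) 0) * (√‖x‖ * exp (-‖x‖) / ‖x‖)
      = √(2 * π) ^ n * (√2 ^ (n + 1) * Gamma ((n + 1) / 2)) := by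
    have : ∀ x : EuclideanSpace ℝ (Fin (n + 1)),
        √(1 + (‖x‖⁻¹ • x) 0) * (√‖x‖ * exp (-‖x‖) / ‖x‖)
        = √(√(x 0 ^ 2 + ∑ i : Fin n, x i.succ ^ 2) + x 0)
          * exp (-√(x 0 ^ 2 + ∑ i : Fin n, x i.succ ^ 2))
          / √(x 0 ^ 2 + ∑ i : Fin n, x i.succ ^ 2) := by
      intro x
      rw [← norm_sq_euclideanSpace_succ, sqrt_sq (norm_nonneg x)]
      rcases eq_or_ne x 0 with rfl | hx
      · simp
      · have hx := norm_pos_iff.2 hx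
        have h1 : ‖x‖ + x 0 = ‖x‖ * (1 + (‖x‖⁻¹ • x) 0) := by
          rw [PiLp.smul_apply, smul_eq_mul]
          field_simp
        rw [h1, sqrt_mul hx.le]
        ring
    simp_rw [this]
    rw [integral_euclideanSpace_succ fun t y ↦ √(√(t ^ 2 + ∑ i, y i ^ 2) + t)
        * exp (-√(t ^ 2 + ∑ i, y i ^ 2)) / √(t ^ 2 + ∑ i, y i ^ 2),
      integral_eq_lintegral_of_nonneg_ae (ae_of_all _ fun _ ↦ by positivity)
        (Measurable.aestronglyMeasurable (by fun_prop)),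
      lintegral_parabolic_coordinates hn, ENNReal.toReal_ofReal]
    have := Gamma_pos_of_pos (s := ((n : ℝ) + 1) / 2) (by positivity)
    positivity
  rw [finrank_euclideanSpace_fin, Nat.add_sub_cancel, hr, hl] at h
  have := Gamma_pos_of_pos (s := (n : ℝ) + 1 / 2) (by positivity)
  rw [h]
  field_simp

theorem toSphere_real_univ_euclideanSpace (n : ℕ) :
    (volume : Measure (EuclideanSpace ℝ (Fin (n + 1)))).toSphere.real Set.univ
      = 2 * √π ^ (n + 1) / Gamma ((n + 1) / 2) := by
  have hpos := Gamma_pos_of_pos (s := ((n : ℝ) + 1) / 2) (by positivity)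
  rw [Measure.toSphere_real_apply_univ, measureReal_def, EuclideanSpace.volume_ball,
    finrank_euclideanSpace_fin, Fintype.card_fin, ENNReal.ofReal_one, one_pow, one_mul]
  push_cast
  rw [Gamma_add_one (by positivity), ENNReal.toReal_ofReal (by positivity)]
  field_simp

theorem integral_toSphere_abs_inner {n : ℕ} (v : EuclideanSpace ℝ (Fin (n + 1))) :
    ∫ ω : sphere (0 : EuclideanSpace ℝ (Fin (n + 1))) 1,
        |⟪v, (ω : EuclideanSpace ℝ (Fin (n + 1)))⟫|
        ∂(volume : Measure (EuclideanSpace ℝ (Fin (n + 1)))).toSphere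
      = ‖v‖ * (2 * √π ^ n / Gamma ((n + 2) / 2)) := by
  simp_rw [real_inner_comm _ v]
  rw [integral_toSphere_inner_eq (fun t ↦ |t|)
    (w := EuclideanSpace.single 0 ‖v‖) (by simp)]
  rw [← integral_toSphere_abs_coord, ← integral_const_mul]
  simp only [EuclideanSpace.inner_single_right, conj_trivial, abs_mul, abs_norm]

theorem integral_toSphere_norm_add {n : ℕ} (hn : n ≠ 0) {e : EuclideanSpace ℝ (Fin (n + 1))}
    (he : ‖e‖ = 1) :
    ∫ ω : sphere (0 : EuclideanSpace ℝ (Fin (n + 1))) 1,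
        ‖e + (ω : EuclideanSpace ℝ (Fin (n + 1)))‖
        ∂(volume : Measure (EuclideanSpace ℝ (Fin (n + 1)))).toSphere
      = 2 ^ (n + 1) * √π ^ n * Gamma ((n + 1) / 2) / Gamma (n + 1 / 2) := by
  have h : ∀ ω : sphere (0 : EuclideanSpace ℝ (Fin (n + 1))) 1,
      ‖e + (ω : EuclideanSpace ℝ (Fin (n + 1)))‖
        = √2 * √(1 + ⟪(ω : EuclideanSpace ℝ (Fin (n + 1))), e⟫) := by
    intro ω
    rw [← sqrt_mul two_pos.le, ← sqrt_sq (norm_nonneg (e + _)), norm_add_sq_real, he,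
      norm_eq_of_mem_sphere, real_inner_comm]
    ring_nf
  simp_rw [h]
  rw [integral_const_mul, integral_toSphere_inner_eq (fun t ↦ √(1 + t))
    (w := EuclideanSpace.single 0 1) (by simp [he])]
  have h2 : √2 ^ n * √2 ^ n = (2 : ℝ) ^ n := by
    rw [← mul_pow, mul_self_sqrt two_pos.le]
  have h3 : √2 * √2 = (2 : ℝ) := mul_self_sqrt two_pos.le
  have := integral_toSphere_sqrt_one_add_coord hn
  simp only [EuclideanSpace.inner_single_right, one_mul, conj_trivial]
  rw [this, sqrt_mul two_pos.le, mul_pow, pow_succ, pow_succ, ← h2]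
  linear_combination (√2 ^ n * √2 ^ n * √π ^ n * Gamma ((n + 1) / 2) / Gamma (n + 1 / 2)) * h3

theorem integral_integral_toSphere_abs_inner_add_eq {E : Type*} [NormedAddCommGroup E]
    [InnerProductSpace ℝ E] [MeasurableSpace E] [BorelSpace E] [FiniteDimensional ℝ E]
    [Nontrivial E] {v w : E} (h : ‖v‖ = ‖w‖) :
    ∫ a : sphere (0 : E) 1, ∫ b : sphere (0 : E) 1, |⟪(a : E) + b, v⟫|
        ∂(volume : Measure E).toSphere ∂(volume : Measure E).toSphere
      = ∫ a : sphere (0 : E) 1, ∫ b : sphere (0 : E) 1, |⟪(a : E) + b, w⟫|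
        ∂(volume : Measure E).toSphere ∂(volume : Measure E).toSphere := by
  obtain ⟨L, rfl⟩ := exists_linearIsometryEquiv_apply_eq h
  rw [← integral_toSphere_comp_linearIsometryEquiv L fun x ↦
    ∫ b : sphere (0 : E) 1, |⟪x + b, L v⟫| ∂(volume : Measure E).toSphere]
  refine integral_congr_ae (ae_of_all _ fun a ↦ ?_)
  simp only
  rw [← integral_toSphere_comp_linearIsometryEquiv L fun x ↦ |⟪L a + x, L v⟫|]
  simp_rw [← map_add, LinearIsometryEquiv.inner_map_map]

theorem integral_integral_integral_swap_of_continuous {X : Type*} [TopologicalSpace X]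
    [CompactSpace X] [R1Space X] [FirstCountableTopology X] [MeasurableSpace X]
    [OpensMeasurableSpace X] (μ : Measure X) [IsFiniteMeasure μ] {F : X → X → X → ℝ}
    (hF : Continuous fun p : X × X × X ↦ F p.1 p.2.1 p.2.2) :
    ∫ z, ∫ a, ∫ b, F z a b ∂μ ∂μ ∂μ = ∫ a, ∫ b, ∫ z, F z a b ∂μ ∂μ ∂μ := by
  have hc : Continuous (Function.uncurry fun z a ↦ ∫ b, F z a b ∂μ) := by
    have := continuous_parametric_integral_of_continuous (μ := μ)
      (f := fun (p : X × X) b ↦ F p.1 p.2 b) (by fun_prop) isCompact_univ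
    simpa [Function.uncurry_def] using this
  rw [integral_integral_swap_of_hasCompactSupport hc (.of_compactSpace _)]
  refine integral_congr_ae (ae_of_all _ fun a ↦ ?_)
  exact integral_integral_swap_of_hasCompactSupport (by fun_prop) (.of_compactSpace _)

theorem integral_abs_inner_add_sphere {d : ℕ} (hd : 2 ≤ d)
    (σ : Measure (sphere (0 : EuclideanSpace ℝ (Fin d)) 1))
    (hσ : σ = (volume : Measure (EuclideanSpace ℝ (Fin d))).toSphere)
    (ζ : EuclideanSpace ℝ (Fin d)) (hζ : ‖ζ‖ = 1) :
    ∫ ω₃ : sphere (0 : EuclideanSpace ℝ (Fin d)) 1,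
      ∫ ω₄ : sphere (0 : EuclideanSpace ℝ (Fin d)) 1,
        |⟪(ω₃ : EuclideanSpace ℝ (Fin d)) + (ω₄ : EuclideanSpace ℝ (Fin d)), ζ⟫| ∂σ ∂σ
      = (2 ^ (d - 1) * Gamma (d / 2) ^ 3
          / (π * Gamma (d - 1 / 2) * Gamma ((d + 1) / 2)))
        * (σ Set.univ).toReal ^ 2 := by
  obtain ⟨n, rfl⟩ : ∃ n, d = n + 1 := ⟨d - 1, by omega⟩
  have hn : n ≠ 0 := by omega
  subst hσ
  set σ := (volume : Measure (EuclideanSpace ℝ (Fin (n + 1)))).toSphere with hσ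
  set I := ∫ ω₃, ∫ ω₄, |⟪(ω₃ : EuclideanSpace ℝ (Fin (n + 1))) + ω₄, ζ⟫| ∂σ ∂σ with hI
  have haverage : σ.real Set.univ * I
      = σ.real Set.univ * ((2 ^ (n + 1) * √π ^ n * Gamma ((n + 1) / 2) / Gamma (n + 1 / 2))
        * (2 * √π ^ n / Gamma ((n + 2) / 2))) := by
    calc
      σ.real Set.univ * I = ∫ _z, I ∂σ := by rw [integral_const, smul_eq_mul]
      _ = ∫ z, ∫ a, ∫ b,
          |⟪(a : EuclideanSpace ℝ (Fin (n + 1))) + b, z⟫| ∂σ ∂σ ∂σ := by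
        refine integral_congr_ae (ae_of_all _ fun z ↦ ?_)
        exact integral_integral_toSphere_abs_inner_add_eq
          (by rw [hζ, norm_eq_of_mem_sphere])
      _ = ∫ a, ∫ b, ∫ z,
          |⟪(a : EuclideanSpace ℝ (Fin (n + 1))) + b, z⟫| ∂σ ∂σ ∂σ :=
        integral_integral_integral_swap_of_continuous σ
          (F := fun z a b ↦ |⟪(a : EuclideanSpace ℝ (Fin (n + 1))) + b, z⟫|) (by fun_prop)
      _ = _ := by
        simp_rw [hσ, integral_toSphere_abs_inner, integral_mul_const,
          integral_toSphere_norm_add hn (norm_eq_of_mem_sphere _), integral_const, smul_eq_mul]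
        ring
  have hG := Gamma_pos_of_pos (s := ((n : ℝ) + 1) / 2) (by positivity)
  have hG' := Gamma_pos_of_pos (s := ((n : ℝ) + 2) / 2) (by positivity)
  have hG'' := Gamma_pos_of_pos (s := (n : ℝ) + 1 / 2) (by positivity)
  have huniv := toSphere_real_univ_euclideanSpace n
  rw [← hσ] at huniv
  rw [mul_left_cancel₀ (by rw [huniv]; positivity) haverage, ← measureReal_def, huniv]
  have e1 : ((n + 1 : ℕ) : ℝ) - 1 / 2 = n + 1 / 2 := by push_cast; ring
  have e2 : (((n + 1 : ℕ) : ℝ) + 1) / 2 = (n + 2) / 2 := by push_cast; ring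
  have hπ : √π ^ 2 = π := sq_sqrt pi_pos.le
  have hs : 0 < √π := sqrt_pos.2 pi_pos
  rw [e1, e2, Nat.add_sub_cancel]
  generalize √π = s at hs hπ ⊢
  rw [← hπ]
  push_cast
  field_simp
  ring
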